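/- Let u ∈ C_c^∞((-1,1) × ℝ). Then ∫_{-1}^{1} u(x₁,0)²/(1-x₁²) dx₁ ≤ (π/2) ∫_{(-1,1)×(0,∞)} |∇u|² dx₁ dx₂. (Trace Hardy inequality on the half-strip, obtained by summing the one-sided weights 1/(1-x₁) and 1/(1+x₁).) -/

import Mathlib

open MeasureTheory

noncomputable def trPhi (s : ℝ) (p : ℝ × ℝ) : ℝ := Real.pi / 2 - Real.arctan (p.2 / (1 - s * p.1))
noncomputable def trD (s : ℝ) (p : ℝ × ℝ) : ℝ := (1 - s * p.1) ^ 2 + p.2 ^ 2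
noncomputable def trA (s : ℝ) (p : ℝ × ℝ) : ℝ := s * p.2 / (trD s p * trPhi s p)
noncomputable def trB (s : ℝ) (p : ℝ × ℝ) : ℝ := (1 - s * p.1) / (trD s p * trPhi s p)

lemma trPhi_pos (s : ℝ) (p : ℝ × ℝ) : 0 < trPhi s p := by
  unfold trPhi
  linarith [Real.arctan_lt_pi_div_two (p.2 / (1 - s * p.1))]

lemma tr_one_sub_pos {s x : ℝ} (hs : s = 1 ∨ s = -1) (hx : x ∈ Set.Ioo (-1 : ℝ) 1) :
    0 < 1 - s * x := by
  rcases hs with rfl | rfl <;> linarith [hx.1, hx.2]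

lemma trD_pos {s : ℝ} {p : ℝ × ℝ} (h : 0 < 1 - s * p.1) : 0 < trD s p := by
  unfold trD; positivity

lemma trPhi_contDiffAt {s : ℝ} {p : ℝ × ℝ} (h : 0 < 1 - s * p.1) :
    ContDiffAt ℝ 1 (trPhi s) p := by
  unfold trPhi
  refine contDiffAt_const.sub (Real.contDiff_arctan.contDiffAt.comp p ?_)
  exact contDiffAt_snd.div (by fun_prop) h.ne'

lemma trA_contDiffAt {s : ℝ} {p : ℝ × ℝ} (h : 0 < 1 - s * p.1) :
    ContDiffAt ℝ 1 (trA s) p := by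
  have h1 := trPhi_contDiffAt h
  have h2 : ContDiffAt ℝ 1 (trD s) p := by unfold trD; fun_prop
  exact ContDiffAt.div (by fun_prop) (h2.mul h1) (mul_pos (trD_pos h) (trPhi_pos s p)).ne'

lemma trB_contDiffAt {s : ℝ} {p : ℝ × ℝ} (h : 0 < 1 - s * p.1) :
    ContDiffAt ℝ 1 (trB s) p := by
  have h1 := trPhi_contDiffAt h
  have h2 : ContDiffAt ℝ 1 (trD s) p := by unfold trD; fun_prop
  exact ContDiffAt.div (by fun_prop) (h2.mul h1) (mul_pos (trD_pos h) (trPhi_pos s p)).ne'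

lemma line1 {f : ℝ × ℝ → ℝ} {p : ℝ × ℝ} (hf : DifferentiableAt ℝ f p) :
    HasDerivAt (fun x => f (x, p.2)) (fderiv ℝ f p (1, 0)) p.1 :=
  HasFDerivAt.comp_hasDerivAt (l := f) (f := fun x => (x, p.2)) p.1 hf.hasFDerivAt
    ((hasDerivAt_id p.1).prodMk (hasDerivAt_const p.1 p.2))

lemma line2 {f : ℝ × ℝ → ℝ} {p : ℝ × ℝ} (hf : DifferentiableAt ℝ f p) :
    HasDerivAt (fun y => f (p.1, y)) (fderiv ℝ f p (0, 1)) p.2 :=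
  HasFDerivAt.comp_hasDerivAt (l := f) (f := fun y => (p.1, y)) p.2 hf.hasFDerivAt
    ((hasDerivAt_const p.2 p.1).prodMk (hasDerivAt_id p.2))

lemma trPhi_d1 {s : ℝ} {p : ℝ × ℝ} (h : 0 < 1 - s * p.1) :
    HasDerivAt (fun x => trPhi s (x, p.2)) (-(s * p.2 / trD s p)) p.1 := by
  have hD := trD_pos h
  unfold trPhi
  have := (((hasDerivAt_const p.1 p.2).div (((hasDerivAt_id p.1).const_mul s).const_sub 1)
    h.ne').arctan).const_sub (Real.pi / 2)
  refine this.congr_deriv ?_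
  unfold trD at *
  simp only [id, Pi.div_apply]
  field_simp
  ring

lemma trPhi_d2 {s : ℝ} {p : ℝ × ℝ} (h : 0 < 1 - s * p.1) :
    HasDerivAt (fun y => trPhi s (p.1, y)) (-((1 - s * p.1) / trD s p)) p.2 := by
  have hD := trD_pos h
  unfold trPhi
  have := ((((hasDerivAt_id p.2).div_const (1 - s * p.1))).arctan).const_sub (Real.pi / 2)
  refine this.congr_deriv ?_
  unfold trD at *
  simp only [id]
  field_simp

lemma tr_div {s : ℝ} {p : ℝ × ℝ} (hs : s ^ 2 = 1) (h : 0 < 1 - s * p.1) :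
    fderiv ℝ (trA s) p (1, 0) + fderiv ℝ (trB s) p (0, 1) = trA s p ^ 2 + trB s p ^ 2 := by
  have hD := trD_pos h
  have hP := trPhi_pos s p
  have a1 := line1 ((trA_contDiffAt h).differentiableAt one_ne_zero)
  have b1 := line2 ((trB_contDiffAt h).differentiableAt one_ne_zero)
  have dD1 : HasDerivAt (fun x => trD s (x, p.2)) (-(2 * s * (1 - s * p.1))) p.1 := by
    unfold trD
    refine (((((hasDerivAt_id p.1).const_mul s).const_sub 1).pow 2).add_const (p.2 ^ 2)).congr_deriv ?_
    simp; ring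
  have dD2 : HasDerivAt (fun y => trD s (p.1, y)) (2 * p.2) p.2 := by
    unfold trD
    refine (((hasDerivAt_id p.2).pow 2).const_add ((1 - s * p.1) ^ 2)).congr_deriv ?_
    simp
  have a2 := (hasDerivAt_const p.1 (s * p.2)).div (dD1.mul (trPhi_d1 h)) (mul_pos hD hP).ne'
  have b2 := (hasDerivAt_const p.2 (1 - s * p.1)).div (dD2.mul (trPhi_d2 h)) (mul_pos hD hP).ne'
  rw [a1.unique a2, b1.unique b2]
  simp only [trA, trB, Pi.mul_apply, Prod.mk.eta]
  generalize trPhi s p = φ at *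
  have e : trD s p = (1 - s * p.1) ^ 2 + p.2 ^ 2 := rfl
  generalize trD s p = D at *
  field_simp
  linear_combination (2 * φ * p.2 * (1 - s * p.1)) * hs

lemma tr_pointwise {s : ℝ} {p : ℝ × ℝ} {u : ℝ × ℝ → ℝ} (hu : DifferentiableAt ℝ u p)
    (hs : s ^ 2 = 1) (h : 0 < 1 - s * p.1) :
    -(fderiv ℝ (fun q => u q ^ 2 * trA s q) p (1, 0)
      + fderiv ℝ (fun q => u q ^ 2 * trB s q) p (0, 1)) ≤
    (fderiv ℝ u p (1, 0)) ^ 2 + (fderiv ℝ u p (0, 1)) ^ 2 := by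
  have hA := (trA_contDiffAt h).differentiableAt one_ne_zero
  have hB := (trB_contDiffAt h).differentiableAt one_ne_zero
  have a := (line1 ((hu.pow 2).mul hA)).unique (((line1 hu).pow 2).mul (line1 hA))
  have b := (line2 ((hu.pow 2).mul hB)).unique (((line2 hu).pow 2).mul (line2 hB))
  have a' : fderiv ℝ (fun q => u q ^ 2 * trA s q) p (1, 0) = _ := a
  have b' : fderiv ℝ (fun q => u q ^ 2 * trB s q) p (0, 1) = _ := b
  rw [a', b']
  have := tr_div hs h
  simp
  nlinarith [sq_nonneg (fderiv ℝ u p (1, 0) + u p * trA s p),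
    sq_nonneg (fderiv ℝ u p (0, 1) + u p * trB s p), congrArg (fun t => u p ^ 2 * t) this]

lemma tr_contDiff {u a : ℝ × ℝ → ℝ} (hu : ContDiff ℝ 1 u)
    (ha : ∀ p ∈ tsupport u, ContDiffAt ℝ 1 a p) :
    ContDiff ℝ 1 (fun q => u q ^ 2 * a q) := by
  rw [contDiff_iff_contDiffAt]
  intro p
  by_cases hp : p ∈ tsupport u
  · exact (hu.contDiffAt.pow 2).mul (ha p hp)
  · have h0 := notMem_tsupport_iff_eventuallyEq.1 hp
    refine (contDiffAt_const (c := (0 : ℝ))).congr_of_eventuallyEq ?_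
    filter_upwards [h0] with q hq
    simp [hq]

lemma tr_half {s : ℝ} (hs : s = 1 ∨ s = -1) (u : ℝ × ℝ → ℝ) (hu : ContDiff ℝ 1 u)
    (hsupp : HasCompactSupport u)
    (hsub : tsupport u ⊆ Set.Ioo (-1 : ℝ) 1 ×ˢ Set.univ) :
    ∫ x₁ in Set.Ioo (-1 : ℝ) 1, (u (x₁, 0)) ^ 2 / (1 - s * x₁) ≤
      (Real.pi / 2) * ∫ p in Set.Ioo (-1 : ℝ) 1 ×ˢ Set.Ioi (0 : ℝ),
        ((fderiv ℝ u p (1, 0)) ^ 2 + (fderiv ℝ u p (0, 1)) ^ 2) := by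
  have hs2 : s ^ 2 = 1 := by rcases hs with rfl | rfl <;> norm_num
  set GA : ℝ × ℝ → ℝ := fun q => u q ^ 2 * trA s q with hGA
  set GB : ℝ × ℝ → ℝ := fun q => u q ^ 2 * trB s q with hGB
  have cA : ContDiff ℝ 1 GA := tr_contDiff hu fun p hp =>
    trA_contDiffAt (tr_one_sub_pos hs (hsub hp).1)
  have cB : ContDiff ℝ 1 GB := tr_contDiff hu fun p hp =>
    trB_contDiffAt (tr_one_sub_pos hs (hsub hp).1)
  have sA : HasCompactSupport GA := hsupp.mono fun q hq hq' => hq (by simp [hGA, hq'])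
  have sB : HasCompactSupport GB := hsupp.mono fun q hq hq' => hq (by simp [hGB, hq'])
  have iA : Integrable (fun p => fderiv ℝ GA p (1, 0)) :=
    ((cA.continuous_fderiv one_ne_zero).clm_apply continuous_const).integrable_of_hasCompactSupport
      (sA.fderiv_apply ℝ (1, 0))
  have iB : Integrable (fun p => fderiv ℝ GB p (0, 1)) :=
    ((cB.continuous_fderiv one_ne_zero).clm_apply continuous_const).integrable_of_hasCompactSupport
      (sB.fderiv_apply ℝ (0, 1))
  have iu (v : ℝ × ℝ) : Integrable (fun p => (fderiv ℝ u p v) ^ 2) := by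
    refine (((hu.continuous_fderiv one_ne_zero).clm_apply
      continuous_const).pow 2).integrable_of_hasCompactSupport ?_
    exact (hsupp.fderiv_apply ℝ v).mono fun q hq hq' => hq (by simp [hq'])
  have u0 (p : ℝ × ℝ) (hp : p.1 ∉ Set.Ioo (-1 : ℝ) 1) : u p = 0 :=
    image_eq_zero_of_notMem_tsupport fun h => hp (hsub h).1
  -- first component
  have eA : ∫ p in Set.Ioo (-1 : ℝ) 1 ×ˢ Set.Ioi (0 : ℝ), fderiv ℝ GA p (1, 0) = 0 := by
    rw [Measure.volume_eq_prod, ← Measure.prod_restrict, integral_prod_symm]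
    · refine integral_eq_zero_of_ae (Filter.Eventually.of_forall fun y => ?_)
      have hd : ∀ x ∈ Set.uIcc (-1 : ℝ) 1,
          HasDerivAt (fun x => GA (x, y)) (fderiv ℝ GA (x, y) (1, 0)) x := fun x _ =>
        line1 (p := (x, y)) (cA.differentiable one_ne_zero (x, y))
      have hc : Continuous fun x => fderiv ℝ GA (x, y) (1, 0) :=
        ((cA.continuous_fderiv one_ne_zero).clm_apply continuous_const).comp
          (Continuous.prodMk_left y)
      have := intervalIntegral.integral_eq_sub_of_hasDerivAt hd (hc.intervalIntegrable _ _)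
      rw [intervalIntegral.integral_of_le (by norm_num), integral_Ioc_eq_integral_Ioo] at this
      simp only [Pi.zero_apply]
      rw [this]
      simp [hGA, u0 (1, y) (by simp), u0 (-1, y) (by simp)]
    · rw [Measure.prod_restrict, ← Measure.volume_eq_prod]
      exact iA.integrableOn
  have eB : ∫ p in Set.Ioo (-1 : ℝ) 1 ×ˢ Set.Ioi (0 : ℝ), fderiv ℝ GB p (0, 1) =
      - ((Real.pi / 2)⁻¹ * ∫ x₁ in Set.Ioo (-1 : ℝ) 1, (u (x₁, 0)) ^ 2 / (1 - s * x₁)) := by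
    rw [Measure.volume_eq_prod, setIntegral_prod, ← integral_const_mul, ← integral_neg]
    · refine setIntegral_congr_fun measurableSet_Ioo fun x hx => ?_
      have hd (y : ℝ) : HasDerivAt (fun y => GB (x, y)) (fderiv ℝ GB (x, y) (0, 1)) y :=
        line2 (p := (x, y)) (cB.differentiable one_ne_zero (x, y))
      have h1 : ContDiff ℝ 1 (fun y => GB (x, y)) := cB.comp (contDiff_prodMk_right x)
      have h2 : HasCompactSupport (fun y => GB (x, y)) :=
        sB.comp_isClosedEmbedding (Topology.IsClosedEmbedding.of_continuous_injective_isClosedMap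
          (Continuous.prodMk_right x) (Prod.mk_right_injective x)
          (isClosedMap_prodMk_left x))
      have := h2.integral_Ioi_deriv_eq h1 0
      simp only [fun y => (hd y).deriv] at this
      rw [this]
      have hx' := tr_one_sub_pos hs hx
      simp only [hGB, trB, trD, trPhi]
      have := Real.pi_pos
      simp
      field_simp
    · rw [← Measure.volume_eq_prod]
      exact iB.integrableOn
  have key : ∫ p in Set.Ioo (-1 : ℝ) 1 ×ˢ Set.Ioi (0 : ℝ),
      -(fderiv ℝ GA p (1, 0) + fderiv ℝ GB p (0, 1)) ≤
      ∫ p in Set.Ioo (-1 : ℝ) 1 ×ˢ Set.Ioi (0 : ℝ),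
        ((fderiv ℝ u p (1, 0)) ^ 2 + (fderiv ℝ u p (0, 1)) ^ 2) := by
    refine setIntegral_mono_on (iA.add iB).neg.integrableOn
      ((iu _).add (iu _)).integrableOn (measurableSet_Ioo.prod measurableSet_Ioi) ?_
    intro p hp
    exact tr_pointwise (hu.differentiable one_ne_zero p) hs2 (tr_one_sub_pos hs hp.1)
  rw [integral_neg, integral_add iA.integrableOn iB.integrableOn, eA, eB, zero_add, neg_neg] at key
  rwa [inv_mul_le_iff₀ (by positivity)] at key

/-- Trace Hardy inequality with one-sided weight `1/(1-x₁²)` on the half-strip: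
for `u` smooth and compactly supported in the open strip `(-1,1) × ℝ`,
`∫_{-1}^{1} u(x₁,0)²/(1-x₁²) dx₁ ≤ (π/2) ∫_{(-1,1)×(0,∞)} |∇u|²`. -/
theorem stmt_2 (u : ℝ × ℝ → ℝ) (hu : ContDiff ℝ (⊤ : ℕ∞) u) (hsupp : HasCompactSupport u)
    (hsub : tsupport u ⊆ Set.Ioo (-1 : ℝ) 1 ×ˢ Set.univ) :
    ∫ x₁ in Set.Ioo (-1 : ℝ) 1, (u (x₁, 0)) ^ 2 / (1 - x₁ ^ 2) ≤
      (Real.pi / 2) * ∫ p in Set.Ioo (-1 : ℝ) 1 ×ˢ Set.Ioi (0 : ℝ),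
        ((fderiv ℝ u p (1, 0)) ^ 2 + (fderiv ℝ u p (0, 1)) ^ 2) := by
  have hu1 : ContDiff ℝ 1 u := hu.of_le (by exact_mod_cast le_top)
  have h1 := tr_half (Or.inl rfl) u hu1 hsupp hsub
  have h2 := tr_half (Or.inr rfl) u hu1 hsupp hsub
  have hint (s : ℝ) (hs : s = 1 ∨ s = -1) :
      IntegrableOn (fun x₁ => (u (x₁, 0)) ^ 2 / (1 - s * x₁)) (Set.Ioo (-1 : ℝ) 1) := by
    have c : ContDiff ℝ 1 (fun q : ℝ × ℝ => u q ^ 2 * (1 - s * q.1)⁻¹) :=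
      tr_contDiff hu1 fun p hp =>
        ContDiffAt.inv (by fun_prop) (tr_one_sub_pos hs (hsub hp).1).ne'
    have c2 : Continuous (fun x₁ => (u (x₁, 0)) ^ 2 / (1 - s * x₁)) :=
      c.continuous.comp (Continuous.prodMk_left (0 : ℝ))
    exact (c2.integrableOn_Icc (a := -1) (b := 1)).mono_set Set.Ioo_subset_Icc_self
  have e : ∫ x₁ in Set.Ioo (-1 : ℝ) 1, (u (x₁, 0)) ^ 2 / (1 - x₁ ^ 2) =
      ∫ x₁ in Set.Ioo (-1 : ℝ) 1, (1 / 2 : ℝ) * ((u (x₁, 0)) ^ 2 / (1 - 1 * x₁)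
        + (u (x₁, 0)) ^ 2 / (1 - (-1) * x₁)) := by
    refine setIntegral_congr_fun measurableSet_Ioo fun x hx => ?_
    have a1 : 1 - x ≠ 0 := by linarith [hx.2]
    have a2 : 1 + x ≠ 0 := by linarith [hx.1]
    have a3 : 1 - x ^ 2 = (1 - x) * (1 + x) := by ring
    simp only [a3, one_mul, neg_mul, sub_neg_eq_add]
    field_simp
    ring
  rw [e, integral_const_mul, integral_add (hint 1 (Or.inl rfl)) (hint (-1) (Or.inr rfl))]
  linarith
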